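/- arXiv:1206.2254 — 6 statements merged into one kernel-verified Lean document; each statement's English description precedes it below -/
import Mathlib

section
/- Let A and D be points on a circle O in the Euclidean plane, let B and C be points interior to the segment AD (with A, B, C, D occurring in this order along the segment, A ≠ B and C ≠ D), and let E and F be points on O such that the chord EF crosses AD at a point X lying between B and C (i.e., X ∈ segment[B,C] ∩ segment[E,F]). Then the distance from the chord EF (as a segment) to the nearer of the two points B and C is at most (|EF|·|BC|) / (2·min(|AB|,|CD|)); that is, min(dist(B, segment[E,F]), dist(C, segment[E,F])) ≤ (dist(E,F)·dist(B,C)) / (2·min(dist(A,B), dist(C,D))). -/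
/-- The power of a point on a chord: the product of its distances to the endpoints. -/
theorem dist_mul_dist_eq_sq_sub_sq_of_mem_segment {V : Type*} [NormedAddCommGroup V]
    [InnerProductSpace ℝ V] {o P Q X : V} {r : ℝ} (hP : dist P o = r) (hQ : dist Q o = r)
    (hX : X ∈ segment ℝ P Q) : dist P X * dist X Q = r ^ 2 - dist X o ^ 2 := by
  obtain ⟨a, b, ha, hb, hab, rfl⟩ := hX
  obtain rfl : a = 1 - b := by linarith
  have hPX : P - ((1 - b) • P + b • Q) = b • (P - Q) := by module
  have hXQ : (1 - b) • P + b • Q - Q = (1 - b) • (P - Q) := by module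
  have hXo : (1 - b) • P + b • Q - o = (P - o) - b • (P - Q) := by module
  have hQo : Q - o = (P - o) - (P - Q) := by module
  rw [dist_eq_norm] at hP hQ
  rw [hQo] at hQ
  have hQ2 := norm_sub_sq_real (P - o) (P - Q)
  rw [hQ, hP] at hQ2
  rw [dist_eq_norm, dist_eq_norm, dist_eq_norm, hPX, hXQ, hXo, norm_sub_sq_real, hP,
    inner_smul_right, norm_smul, norm_smul, Real.norm_of_nonneg ha, Real.norm_of_nonneg hb]
  linear_combination -b * hQ2

/-- Lemma 3, portal spacing. Let `A` and `D` be points on a circle with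
center `o` and radius `r > 0`, let `B` and `C` be points interior to the segment `AD`
occurring in the order `A, B, C, D` (with `A ≠ B` and `C ≠ D`), and let `E`, `F` be points
on the circle such that the chord `EF` crosses `AD` at a point `X` between `B` and `C`.
Then the distance from the segment `EF` to the nearer of `B` and `C` is at most
`(|EF|·|BC|) / (2·min(|AB|,|CD|))`. -/
theorem portal_spacing
    (o A B C D E F X : EuclideanSpace ℝ (Fin 2)) (r : ℝ) (hr : 0 < r)
    (hA : dist A o = r) (hD : dist D o = r) (hE : dist E o = r) (hF : dist F o = r)
    (hB : B ∈ segment ℝ A C) (hC : C ∈ segment ℝ B D)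
    (hAB : A ≠ B) (hCD : C ≠ D)
    (hX₁ : X ∈ segment ℝ B C) (hX₂ : X ∈ segment ℝ E F) :
    min (Metric.infDist B (segment ℝ E F)) (Metric.infDist C (segment ℝ E F)) ≤
      (dist E F * dist B C) / (2 * min (dist A B) (dist C D)) := by
  rcases eq_or_ne B C with rfl | hBC
  · rw [segment_same, Set.mem_singleton_iff] at hX₁
    subst hX₁
    simp [Metric.infDist_zero_of_mem hX₂]
  rw [mem_segment_iff_wbtw] at hB hC hX₁
  have hABX : dist A B + dist B X = dist A X := (hB.trans_right_left hX₁).dist_add_dist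
  have hXCD : dist X C + dist C D = dist X D := (hC.trans_left_right hX₁).dist_add_dist
  have hBXC : dist B X + dist X C = dist B C := hX₁.dist_add_dist
  have hEXF : dist E X + dist X F = dist E F := (mem_segment_iff_wbtw.mp hX₂).dist_add_dist
  have hAXD : Wbtw ℝ A X D := (hB.trans_expand_right hC hBC).trans_left (hB.trans_right hX₁)
  have hpow : dist A X * dist X D = dist E X * dist X F :=
    (dist_mul_dist_eq_sq_sub_sq_of_mem_segment hA hD (mem_segment_iff_wbtw.mpr hAXD)).trans
      (dist_mul_dist_eq_sq_sub_sq_of_mem_segment hE hF hX₂).symm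
  set m := min (dist A B) (dist C D)
  have hm : 0 < m := lt_min (dist_pos.mpr hAB) (dist_pos.mpr hCD)
  have hmAX : m ≤ dist A X := by
    linarith [min_le_left (dist A B) (dist C D), dist_nonneg (x := B) (y := X)]
  have hmXD : m ≤ dist X D := by
    linarith [min_le_right (dist A B) (dist C D), dist_nonneg (x := X) (y := C)]
  have hEF : 2 * m ≤ dist E F := by
    refine le_of_pow_le_pow_left₀ two_ne_zero dist_nonneg ?_
    have hmul := mul_le_mul hmAX hmXD hm.le dist_nonneg
    rw [hpow] at hmul
    rw [← hEXF]
    linarith [sq_nonneg (dist E X - dist X F)]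
  calc _ ≤ Metric.infDist B (segment ℝ E F) := min_le_left _ _
    _ ≤ dist B X := Metric.infDist_le_dist_of_mem hX₂
    _ ≤ dist B C := by linarith [dist_nonneg (x := X) (y := C)]
    _ ≤ _ := by
      rw [le_div_iff₀ (by positivity), mul_comm]
      exact mul_le_mul_of_nonneg_right hEF dist_nonneg
end

section
/- Let A, D, E, F be points on a circle O in the Euclidean plane, and suppose the chords AD and EF intersect, i.e., there is a point X with X ∈ segment[A,D] ∩ segment[E,F]. Then dist(E,F) ≥ min(dist(A,X), dist(X,D)). -/
/-- If `AD` and `EF` are chords of a circle (center `o`, radius `r > 0`)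
that intersect at a point `X`, then `|EF| ≥ min(|AX|, |XD|)`. -/
theorem chord_crossing_length
    (o A D E F X : EuclideanSpace ℝ (Fin 2)) (r : ℝ) (hr : 0 < r)
    (hA : dist A o = r) (hD : dist D o = r) (hE : dist E o = r) (hF : dist F o = r)
    (hX₁ : X ∈ segment ℝ A D) (hX₂ : X ∈ segment ℝ E F) :
    min (dist A X) (dist X D) ≤ dist E F := by
  have hcosph : EuclideanGeometry.Cospherical ({A, D, E, F} : Set (EuclideanSpace ℝ (Fin 2))) :=
    ⟨o, r, by simp [hA, hD, hE, hF]⟩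
  have hpow : dist A X * dist X D = dist E X * dist X F := by
    rw [dist_comm X D, dist_comm X F]
    exact EuclideanGeometry.mul_dist_eq_mul_dist_of_cospherical hcosph
      (mem_segment_iff_wbtw.1 hX₁).mem_affineSpan (mem_segment_iff_wbtw.1 hX₂).mem_affineSpan
  rw [← dist_add_dist_of_mem_segment hX₂]
  have hE₀ : 0 ≤ dist E X := dist_nonneg
  have hF₀ : 0 ≤ dist X F := dist_nonneg
  refine le_of_pow_le_pow_left₀ two_ne_zero (by positivity) ?_
  calc min (dist A X) (dist X D) ^ 2
      = min (dist A X) (dist X D) * min (dist A X) (dist X D) := sq _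
    _ ≤ dist A X * dist X D :=
        mul_le_mul (min_le_left _ _) (min_le_right _ _) (by positivity) dist_nonneg
    _ = dist E X * dist X F := hpow
    _ ≤ (dist E X + dist X F) ^ 2 := by nlinarith [mul_nonneg hE₀ hF₀]
end

section
/- There is an absolute constant c > 0 with the following property. For every ε with 0 < ε < 1 and every line segment s = segment[a,b] (a ≠ b) in the Euclidean plane, there exists a finite set P of points on s with |P| ≤ c·(1/ε)·(1 + log(1/ε)) such that: for every circle O for which s is a chord (i.e., a and b both lie on O), and for every chord t = segment[e,f] of O (e, f on O) that intersects s, there is a point p ∈ P whose distance to the segment t is at most ε·dist(e,f). -/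
open AffineMap in
/-- Stewart's theorem in an inner product space. -/
theorem dist_sq_lineMap_left {V : Type*} [NormedAddCommGroup V] [InnerProductSpace ℝ V]
    (a b o : V) (t : ℝ) :
    dist (lineMap a b t) o ^ 2 =
      (1 - t) * dist a o ^ 2 + t * dist b o ^ 2 - t * (1 - t) * dist a b ^ 2 := by
  have h₁ : lineMap a b t - o = (1 - t) • (a - o) + t • (b - o) := by
    rw [lineMap_apply_module]; module
  have h₂ : a - b = (a - o) - (b - o) := by abel
  rw [dist_eq_norm, dist_eq_norm, dist_eq_norm, dist_eq_norm a b, h₁, h₂, norm_add_sq_real,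
    norm_sub_sq_real (a - o), norm_smul, norm_smul, inner_smul_left, inner_smul_right,
    mul_pow, mul_pow,
    Real.norm_eq_abs, Real.norm_eq_abs, sq_abs, sq_abs]
  simp only [conj_trivial]
  ring

open AffineMap in
/-- Two crossing chords of a sphere: the power of the crossing point with respect to one chord is
at most a quarter of the squared length of the other. -/
theorem four_mul_dist_sq_le_of_mem_segment {V : Type*} [NormedAddCommGroup V]
    [InnerProductSpace ℝ V] {a b e f o : V} {r t : ℝ} (ha : dist a o = r) (hb : dist b o = r)
    (he : dist e o = r) (hf : dist f o = r) (hx : lineMap a b t ∈ segment ℝ e f) :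
    4 * (t * (1 - t)) * dist a b ^ 2 ≤ dist e f ^ 2 := by
  rw [segment_eq_image_lineMap] at hx
  obtain ⟨s, -, hs⟩ := hx
  have h₁ := dist_sq_lineMap_left a b o t
  have h₂ := dist_sq_lineMap_left e f o s
  rw [hs, h₁, ha, hb, he, hf] at h₂
  nlinarith [mul_nonneg (sq_nonneg (2 * s - 1)) (sq_nonneg (dist e f))]

open AffineMap in
/-- The points at parameters `(i / N) ^ 2` approximate the points of the first half of a segment
with an error controlled by the product of the distances to the two endpoints. -/
theorem exists_dist_lineMap_sq_le {V : Type*} [NormedAddCommGroup V] [InnerProductSpace ℝ V]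
    {a b : V} {t D ε : ℝ} {N : ℕ} (hN : 0 < N) (hNε : 2 / N ≤ ε) (ht₀ : 0 ≤ t) (ht : t ≤ 1 / 2)
    (hD₀ : 0 ≤ D) (hD : 4 * (t * (1 - t)) * dist a b ^ 2 ≤ D ^ 2) :
    ∃ i ∈ Finset.range (N + 1),
      dist (lineMap a b (((i : ℝ) / N) ^ 2)) (lineMap a b t) ≤ ε * D := by
  have hN' : (0 : ℝ) < N := by exact_mod_cast hN
  set y := √t with hy
  have hy₀ : 0 ≤ y := Real.sqrt_nonneg t
  have hyt : y ^ 2 = t := Real.sq_sqrt ht₀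
  have hy₁ : y ≤ 1 := by nlinarith
  have hfloor : (⌊y * N⌋₊ : ℝ) ≤ y * N := Nat.floor_le (by positivity)
  have hlt : y * N < ⌊y * N⌋₊ + 1 := Nat.lt_floor_add_one _
  refine ⟨⌊y * N⌋₊, ?_, ?_⟩
  · rw [Finset.mem_range, Nat.lt_succ_iff]
    exact_mod_cast hfloor.trans (mul_le_of_le_one_left hN'.le hy₁)
  set z : ℝ := (⌊y * N⌋₊ : ℝ) / N with hz
  have hz₀ : 0 ≤ z := by positivity
  have hzy : z ≤ y := by rwa [hz, div_le_iff₀ hN']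
  have hyz : y - z ≤ 1 / N := by
    rw [hz, le_div_iff₀ hN', sub_mul, div_mul_cancel₀ _ hN'.ne']
    linarith
  have hyD : y * dist a b ≤ D := by
    refine le_of_sq_le_sq ?_ hD₀
    rw [mul_pow, hyt]
    nlinarith [mul_nonneg (mul_nonneg ht₀ (by linarith : 0 ≤ 3 - 4 * t)) (sq_nonneg (dist a b))]
  rw [dist_lineMap_lineMap, Real.dist_eq, abs_sub_comm, ← hyt,
    abs_of_nonneg (by nlinarith : 0 ≤ y ^ 2 - z ^ 2)]
  calc (y ^ 2 - z ^ 2) * dist a b = (y - z) * (y + z) * dist a b := by ring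
    _ ≤ 1 / N * (2 * y) * dist a b := by gcongr; linarith
    _ = 2 / N * (y * dist a b) := by ring
    _ ≤ ε * D := mul_le_mul hNε hyD (by positivity) (le_trans (by positivity) hNε)


/-- Lemma 4, portals. There is an absolute constant `c > 0` such that
for every `0 < ε < 1` and every nondegenerate segment `s = [a,b]` in the plane, there is a
finite set `P` of points on `s` with `|P| ≤ c·(1/ε)·(1 + log(1/ε))` such that for every
circle having `s` as a chord, every chord `t = [e,f]` of that circle crossing `s` passes
within distance `ε·|ef|` of some point of `P`. -/
theorem portals_exist :
    ∃ c : ℝ, 0 < c ∧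
      ∀ ε : ℝ, 0 < ε → ε < 1 →
        ∀ a b : EuclideanSpace ℝ (Fin 2), a ≠ b →
          ∃ P : Finset (EuclideanSpace ℝ (Fin 2)),
            (P : Set (EuclideanSpace ℝ (Fin 2))) ⊆ segment ℝ a b ∧
            (P.card : ℝ) ≤ c * (1 / ε) * (1 + Real.log (1 / ε)) ∧
            ∀ (o : EuclideanSpace ℝ (Fin 2)) (r : ℝ), 0 < r →
              dist a o = r → dist b o = r →
              ∀ e f : EuclideanSpace ℝ (Fin 2), dist e o = r → dist f o = r →
                (segment ℝ e f ∩ segment ℝ a b).Nonempty →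
                ∃ p ∈ P, Metric.infDist p (segment ℝ e f) ≤ ε * dist e f := by
  classical
  refine ⟨8, by norm_num, fun ε hε₀ hε₁ a b _ => ?_⟩
  set N := ⌈2 / ε⌉₊ with hN
  have hN₀ : 0 < N := Nat.ceil_pos.2 (by positivity)
  have hN' : (0 : ℝ) < N := by exact_mod_cast hN₀
  have hNε : 2 / (N : ℝ) ≤ ε := by
    rw [div_le_comm₀ hN' hε₀]
    exact Nat.le_ceil _
  let portals (u v : EuclideanSpace ℝ (Fin 2)) : Finset (EuclideanSpace ℝ (Fin 2)) :=
    (Finset.range (N + 1)).image fun i : ℕ => AffineMap.lineMap u v (((i : ℝ) / N) ^ 2)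
  have hsub (u v : EuclideanSpace ℝ (Fin 2)) : ∀ p ∈ portals u v, p ∈ segment ℝ u v := by
    intro p hp
    obtain ⟨i, hi, rfl⟩ := Finset.mem_image.1 hp
    have hiN : (i : ℝ) ≤ N := by exact_mod_cast Nat.lt_succ_iff.1 (Finset.mem_range.1 hi)
    rw [segment_eq_image_lineMap]
    exact ⟨_, ⟨by positivity, pow_le_one₀ (by positivity) (div_le_one_of_le₀ hiN hN'.le)⟩, rfl⟩
  have hcard (u v : EuclideanSpace ℝ (Fin 2)) : (portals u v).card ≤ N + 1 :=
    Finset.card_image_le.trans (Finset.card_range _).le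
  refine ⟨portals a b ∪ portals b a, fun p hp => ?_, ?_, ?_⟩
  · rcases Finset.mem_union.1 hp with hp | hp
    · exact hsub a b p hp
    · rw [segment_symm]
      exact hsub b a p hp
  · have hle : ((portals a b ∪ portals b a).card : ℝ) ≤ 2 * (N + 1) := by
      exact_mod_cast (Finset.card_union_le _ _).trans
        (by linarith [hcard a b, hcard b a] : _ ≤ 2 * (N + 1))
    have hceil : (N : ℝ) < 2 / ε + 1 := Nat.ceil_lt_add_one (by positivity)
    have hinv : 1 ≤ 1 / ε := by rw [le_div_iff₀ hε₀]; linarith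
    have hlog : 0 ≤ Real.log (1 / ε) := Real.log_nonneg hinv
    have htwo : 2 / ε = 2 * (1 / ε) := by ring
    nlinarith [mul_nonneg (zero_le_one.trans hinv) hlog]
  · rintro o r - ha hb e f he hf ⟨x, hxt, hxs⟩
    suffices h : ∃ p ∈ portals a b ∪ portals b a, dist p x ≤ ε * dist e f by
      obtain ⟨p, hp, hpx⟩ := h
      exact ⟨p, hp, (Metric.infDist_le_dist_of_mem hxt).trans hpx⟩
    have hhalf : ∀ u v : EuclideanSpace ℝ (Fin 2), dist u o = r → dist v o = r → ∀ t : ℝ,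
        0 ≤ t → t ≤ 1 / 2 → AffineMap.lineMap u v t = x →
        ∃ p ∈ portals u v, dist p x ≤ ε * dist e f := by
      rintro u v hu hv t ht₀ ht rfl
      obtain ⟨i, hi, hd⟩ := exists_dist_lineMap_sq_le hN₀ hNε ht₀ ht dist_nonneg
        (four_mul_dist_sq_le_of_mem_segment hu hv he hf hxt)
      exact ⟨_, Finset.mem_image_of_mem _ hi, hd⟩
    rw [segment_eq_image_lineMap] at hxs
    obtain ⟨t, ⟨ht₀, ht₁⟩, htx⟩ := hxs
    rcases le_total t (1 / 2) with ht | ht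
    · obtain ⟨p, hp, hd⟩ := hhalf a b ha hb t ht₀ ht htx
      exact ⟨p, Finset.mem_union_left _ hp, hd⟩
    · obtain ⟨p, hp, hd⟩ := hhalf b a hb ha (1 - t) (by linarith) (by linarith)
        (by rw [AffineMap.lineMap_apply_one_sub, htx])
      exact ⟨p, Finset.mem_union_right _ hp, hd⟩
end

section
/- Let u be a unit vector in the Euclidean plane, let 0 ≤ δ < π/2, and let p₀, p₁, …, p_k be a finite sequence of points such that for each i the displacement vector p_{i+1} − p_i is nonzero and makes an angle at most δ with u (equivalently, ⟪p_{i+1} − p_i, u⟫ ≥ ‖p_{i+1} − p_i‖·cos δ). Then the total length of the path, Σ_i ‖p_{i+1} − p_i‖, is at most dist(p₀, p_k) / cos δ. In particular the path length is at most (1 + O(δ²)) times the distance between its endpoints. -/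
open scoped RealInnerProductSpace

/-- A path whose segments all satisfy `‖p (i + 1) - p i‖ * c ≤ ⟪p (i + 1) - p i, u⟫` for a unit
vector `u` has length at most `dist (p 0) (p k) / c`. -/
theorem sum_dist_le_dist_div_of_norm_mul_le_inner {E : Type*} [NormedAddCommGroup E]
    [InnerProductSpace ℝ E] {u : E} (hu : ‖u‖ = 1) {c : ℝ} (hc : 0 < c) (k : ℕ) (p : ℕ → E)
    (h : ∀ i < k, ‖p (i + 1) - p i‖ * c ≤ ⟪p (i + 1) - p i, u⟫) :
    ∑ i ∈ Finset.range k, dist (p i) (p (i + 1)) ≤ dist (p 0) (p k) / c := by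
  rw [le_div_iff₀ hc, Finset.sum_mul]
  calc ∑ i ∈ Finset.range k, dist (p i) (p (i + 1)) * c
      ≤ ∑ i ∈ Finset.range k, ⟪p (i + 1) - p i, u⟫ := by
        refine Finset.sum_le_sum fun i hi => ?_
        rw [dist_comm, dist_eq_norm]
        exact h i (Finset.mem_range.mp hi)
    _ = ⟪p k - p 0, u⟫ := by rw [← sum_inner, Finset.sum_range_sub]
    _ ≤ ‖p k - p 0‖ * ‖u‖ := real_inner_le_norm _ _
    _ = dist (p 0) (p k) := by rw [hu, mul_one, dist_comm, dist_eq_norm]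

/-- Lemma 5, angle-bounded paths are short. Let `u` be a unit vector in
the plane and `0 ≤ δ < π/2`. If `p 0, p 1, …, p k` is a polygonal path each of whose
segments is nonzero and makes angle at most `δ` with `u` (i.e.
`⟪p (i+1) - p i, u⟫ ≥ ‖p (i+1) - p i‖·cos δ`), then the total length of the path is at
most `dist (p 0) (p k) / cos δ`. -/
theorem angle_bounded_path_short
    (u : EuclideanSpace ℝ (Fin 2)) (hu : ‖u‖ = 1)
    (δ : ℝ) (hδ₀ : 0 ≤ δ) (hδ₁ : δ < Real.pi / 2)
    (k : ℕ) (p : ℕ → EuclideanSpace ℝ (Fin 2))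
    (hne : ∀ i < k, p (i + 1) - p i ≠ 0)
    (hang : ∀ i < k, ‖p (i + 1) - p i‖ * Real.cos δ ≤ ⟪p (i + 1) - p i, u⟫) :
    ∑ i ∈ Finset.range k, dist (p i) (p (i + 1)) ≤ dist (p 0) (p k) / Real.cos δ := by
  exact sum_dist_le_dist_div_of_norm_mul_le_inner hu
    (Real.cos_pos_of_mem_Ioo ⟨by linarith [Real.pi_pos], hδ₁⟩) k p hang
end

section
/- Let A, B, C be three pairwise distinct, non-collinear points in the Euclidean plane, and let α > 0 be such that the angles of the triangle at A and at B (i.e., ∠CAB and ∠CBA) are each at least α. Then dist(A,B) ≤ (dist(C,A) + dist(C,B))·cos α. -/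
/-- The projection formula: a side of a triangle is the sum of the signed projections of the
other two sides onto it. -/
theorem dist_eq_dist_mul_cos_angle_add_dist_mul_cos_angle
    {V P : Type*} [NormedAddCommGroup V] [InnerProductSpace ℝ V] [MetricSpace P]
    [NormedAddTorsor V P] {A B : P} (hAB : A ≠ B) (C : P) :
    dist A B = dist C A * Real.cos (EuclideanGeometry.angle C A B) +
      dist C B * Real.cos (EuclideanGeometry.angle C B A) := by
  have hA := EuclideanGeometry.dist_sq_eq_dist_sq_add_dist_sq_sub_two_mul_dist_mul_dist_mul_cos_angle
    C A B
  have hB := EuclideanGeometry.dist_sq_eq_dist_sq_add_dist_sq_sub_two_mul_dist_mul_dist_mul_cos_angle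
    C B A
  rw [dist_comm B A] at hA
  refine mul_left_cancel₀ (dist_ne_zero.2 hAB) ?_
  linarith

/-- key inequality of Lemma 1. If `A`, `B`, `C` are pairwise distinct,
non-collinear points in the plane and the angles of the triangle at `A` and at `B` are
each at least `α > 0`, then `|AB| ≤ (|CA| + |CB|)·cos α`. -/
theorem side_le_sum_mul_cos
    (A B C : EuclideanSpace ℝ (Fin 2))
    (hAB : A ≠ B) (hAC : A ≠ C) (hBC : B ≠ C)
    (hcol : ¬ Collinear ℝ ({A, B, C} : Set (EuclideanSpace ℝ (Fin 2))))
    (α : ℝ) (hα : 0 < α)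
    (hA : α ≤ EuclideanGeometry.angle C A B)
    (hB : α ≤ EuclideanGeometry.angle C B A) :
    dist A B ≤ (dist C A + dist C B) * Real.cos α := by
  rw [dist_eq_dist_mul_cos_angle_add_dist_mul_cos_angle hAB C, add_mul]
  have hcosA := Real.cos_le_cos_of_nonneg_of_le_pi hα.le (EuclideanGeometry.angle_le_pi C A B) hA
  have hcosB := Real.cos_le_cos_of_nonneg_of_le_pi hα.le (EuclideanGeometry.angle_le_pi C B A) hB
  gcongr
end

section
/- Let S be a finite set of points in the Euclidean plane in general position (no three points of S collinear and no four points of S concyclic), and let α > 0 be such that every triangle with vertices q, r, s ∈ S whose open circumdisk contains no point of S has all three of its angles at least α. Then for every point x of the plane, the number of three-element subsets {q, r, s} of S that span a triangle whose open circumdisk contains no point of S but does contain x is at most 2π/α. -/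
/-- The power of the point `p` with respect to the circle of center `u` for which the origin has
power `-k`. -/
def circlePower (u : ℂ) (k : ℝ) (p : ℂ) : ℝ :=
  p.re ^ 2 + p.im ^ 2 - 2 * (u.re * p.re + u.im * p.im) - k

/-- The cross product of two plane vectors. -/
def planeCross (p q : ℂ) : ℝ := p.re * q.im - p.im * q.re

theorem planeCross_eq (p q : ℂ) :
    planeCross p q = ‖p‖ * ‖q‖ * Real.sin (q.arg - p.arg) := by
  rw [Real.sin_sub, planeCross]
  linear_combination (-q.im) * Complex.norm_mul_cos_arg p + q.re * Complex.norm_mul_sin_arg p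
    - ‖p‖ * p.arg.cos * Complex.norm_mul_sin_arg q + ‖p‖ * p.arg.sin * Complex.norm_mul_cos_arg q

theorem eq_zero_of_sq_add_sq_nonpos {x y : ℝ} (h : x ^ 2 + y ^ 2 ≤ 0) : x = 0 ∧ y = 0 := by
  constructor <;> nlinarith [sq_nonneg x, sq_nonneg y]

theorem planeCross_pos {p q : ℂ} (hp : p ≠ 0) (hq : q ≠ 0) (h : 0 < Real.sin (q.arg - p.arg)) :
    0 < planeCross p q := by
  rw [planeCross_eq]
  have := norm_pos_iff.2 hp
  have := norm_pos_iff.2 hq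
  positivity

theorem circle_eq_of_mem_cone {a b c d u v : ℂ} {k l : ℝ} (hl : 0 < l) (hkl : l ≤ k)
    (ha : circlePower u k a = 0) (hb : circlePower u k b = 0)
    (hc : circlePower v l c = 0) (hd : circlePower v l d = 0)
    (ha' : 0 ≤ circlePower v l a) (hb' : 0 ≤ circlePower v l b)
    (hc' : 0 ≤ circlePower u k c) (hd' : 0 ≤ circlePower u k d)
    (hbd : 0 < planeCross b d) (hcb : 0 < planeCross c b)
    (hcd : 0 < planeCross c d ∨ planeCross c d = 0 ∧ 0 < planeCross a c) :
    u = v ∧ k = l := by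
  obtain ⟨a1, a2⟩ := a
  obtain ⟨b1, b2⟩ := b
  obtain ⟨c1, c2⟩ := c
  obtain ⟨d1, d2⟩ := d
  obtain ⟨u1, u2⟩ := u
  obtain ⟨v1, v2⟩ := v
  simp only [circlePower, planeCross, Complex.mk.injEq] at *
  obtain ⟨w1, hw1⟩ : ∃ w, w = 2 * (u1 - v1) := ⟨_, rfl⟩
  obtain ⟨w2, hw2⟩ : ∃ w, w = 2 * (u2 - v2) := ⟨_, rfl⟩
  have la : 0 ≤ w1 * a1 + w2 * a2 + (k - l) := by subst hw1 hw2; linarith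
  have lb : 0 ≤ w1 * b1 + w2 * b2 + (k - l) := by subst hw1 hw2; linarith
  have lc : w1 * c1 + w2 * c2 + (k - l) ≤ 0 := by subst hw1 hw2; linarith
  have ld : w1 * d1 + w2 * d2 + (k - l) ≤ 0 := by subst hw1 hw2; linarith
  obtain ⟨N, hN⟩ : ∃ N, N = b1 * d2 - b2 * d1 := ⟨_, rfl⟩
  obtain ⟨K, hK⟩ : ∃ N, N = c1 * b2 - c2 * b1 := ⟨_, rfl⟩
  obtain ⟨X, hX⟩ : ∃ N, N = c1 * d2 - c2 * d1 := ⟨_, rfl⟩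
  have e1 : X * b1 = N * c1 + K * d1 := by subst hN hK hX; ring
  have e2 : X * b2 = N * c2 + K * d2 := by subst hN hK hX; ring
  rw [← hN] at hbd
  rw [← hK] at hcb
  rw [← hX] at hcd
  have hX0 : 0 ≤ X := by rcases hcd with h | h <;> linarith
  have key : X * (w1 * b1 + w2 * b2) = N * (w1 * c1 + w2 * c2) + K * (w1 * d1 + w2 * d2) := by
    linear_combination w1 * e1 + w2 * e2
  have h1 : N * (w1 * c1 + w2 * c2 + (k - l)) ≤ 0 := mul_nonpos_of_nonneg_of_nonpos hbd.le lc
  have h2 : K * (w1 * d1 + w2 * d2 + (k - l)) ≤ 0 := mul_nonpos_of_nonneg_of_nonpos hcb.le ld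
  have h3 : 0 ≤ X * (w1 * b1 + w2 * b2 + (k - l)) := mul_nonneg hX0 lb
  have h4 : (N + K - X) * (k - l) ≤ 0 := by linarith
  rcases hkl.lt_or_eq with hlt | heq
  · exfalso
    have h5 : N + K ≤ X := by
      by_contra! h
      have := mul_pos (sub_pos.2 h) (sub_pos.2 hlt)
      linarith
    have hXp : 0 < X := by linarith
    have id : X * (X * (b1 ^ 2 + b2 ^ 2 - 2 * (v1 * b1 + v2 * b2) - l))
        = N * (N + K) * (c1 ^ 2 + c2 ^ 2) + K * (N + K) * (d1 ^ 2 + d2 ^ 2)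
          - N * K * ((c1 - d1) ^ 2 + (c2 - d2) ^ 2)
          - X * (N * (c1 ^ 2 + c2 ^ 2 - l) + K * (d1 ^ 2 + d2 ^ 2 - l)) - X ^ 2 * l := by
      have hc2 : 2 * (v1 * c1 + v2 * c2) = c1 ^ 2 + c2 ^ 2 - l := by linarith
      have hd2 : 2 * (v1 * d1 + v2 * d2) = d1 ^ 2 + d2 ^ 2 - l := by linarith
      rw [← hc2, ← hd2]
      linear_combination (X * b1 + N * c1 + K * d1 - 2 * v1 * X) * e1
        + (X * b2 + N * c2 + K * d2 - 2 * v2 * X) * e2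
    have hne : 0 < (c1 - d1) ^ 2 + (c2 - d2) ^ 2 := by
      by_contra! h
      obtain ⟨z1, z2⟩ := eq_zero_of_sq_add_sq_nonpos h
      have : X = 0 := by rw [hX]; linear_combination d2 * z1 - d1 * z2
      linarith
    have t1 : 0 < N * K * ((c1 - d1) ^ 2 + (c2 - d2) ^ 2) := by positivity
    have t2 : 0 ≤ X * (X * (b1 ^ 2 + b2 ^ 2 - 2 * (v1 * b1 + v2 * b2) - l)) :=
      mul_nonneg hX0 (mul_nonneg hX0 hb')
    have t3 : 0 ≤ (X - (N + K)) * (N * (c1 ^ 2 + c2 ^ 2) + K * (d1 ^ 2 + d2 ^ 2)) :=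
      mul_nonneg (sub_nonneg.2 h5) (by positivity)
    have t4 : 0 ≤ X * (X - (N + K)) * l :=
      mul_nonneg (mul_nonneg hX0 (sub_nonneg.2 h5)) hl.le
    linarith
  · subst heq
    have zc : w1 * c1 + w2 * c2 = 0 := by
      have : N * (w1 * c1 + w2 * c2) = 0 := by linarith
      exact (mul_eq_zero.1 this).resolve_left hbd.ne'
    have zd : w1 * d1 + w2 * d2 = 0 := by
      have : K * (w1 * d1 + w2 * d2) = 0 := by linarith
      exact (mul_eq_zero.1 this).resolve_left hcb.ne'
    suffices h : w1 = 0 ∧ w2 = 0 by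
      refine ⟨⟨?_, ?_⟩, rfl⟩ <;> linarith [h.1, h.2]
    rcases hcd with h | ⟨-, h⟩
    · constructor
      · have : X * w1 = 0 := by rw [hX]; linear_combination d2 * zc - c2 * zd
        exact (mul_eq_zero.1 this).resolve_left h.ne'
      · have : X * w2 = 0 := by rw [hX]; linear_combination c1 * zd - d1 * zc
        exact (mul_eq_zero.1 this).resolve_left h.ne'
    · have hcc : 0 < c1 ^ 2 + c2 ^ 2 := by
        by_contra! h'
        obtain ⟨z1, z2⟩ := eq_zero_of_sq_add_sq_nonpos h'
        rw [z1, z2] at h; linarith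
      obtain ⟨τ, hτ⟩ : ∃ τ, τ = c1 * w2 - c2 * w1 := ⟨_, rfl⟩
      have ib : (c1 ^ 2 + c2 ^ 2) * (w1 * b1 + w2 * b2) = K * τ := by
        rw [hK, hτ]; linear_combination (c1 * b1 + c2 * b2) * zc
      have ia : (c1 ^ 2 + c2 ^ 2) * (w1 * a1 + w2 * a2) = -(a1 * c2 - a2 * c1) * τ := by
        rw [hτ]; linear_combination (c1 * a1 + c2 * a2) * zc
      have τ0 : 0 ≤ τ := by
        have : 0 ≤ K * τ := ib ▸ mul_nonneg hcc.le (by linarith)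
        exact nonneg_of_mul_nonneg_right this hcb
      have τ1 : τ ≤ 0 := by
        have : 0 ≤ -(a1 * c2 - a2 * c1) * τ := ia ▸ mul_nonneg hcc.le (by linarith)
        by_contra! h'
        have := mul_pos h h'
        linarith
      have τz : τ = 0 := le_antisymm τ1 τ0
      constructor
      · have : (c1 ^ 2 + c2 ^ 2) * w1 = 0 := by linear_combination c1 * zc - c2 * τz + c2 * hτ
        exact (mul_eq_zero.1 this).resolve_left hcc.ne'
      · have : (c1 ^ 2 + c2 ^ 2) * w2 = 0 := by linear_combination c2 * zc + c1 * τz - c1 * hτ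
        exact (mul_eq_zero.1 this).resolve_left hcc.ne'

theorem circle_eq_of_interleave {a b c d u v : ℂ} {k l : ℝ} (hk : 0 < k) (hl : 0 < l)
    (a0 : a ≠ 0) (b0 : b ≠ 0) (c0 : c ≠ 0) (d0 : d ≠ 0)
    (ha : circlePower u k a = 0) (hb : circlePower u k b = 0)
    (hc : circlePower v l c = 0) (hd : circlePower v l d = 0)
    (ha' : 0 ≤ circlePower v l a) (hb' : 0 ≤ circlePower v l b)
    (hc' : 0 ≤ circlePower u k c) (hd' : 0 ≤ circlePower u k d)
    (hac : a.arg < c.arg) (hcb : c.arg < b.arg) (hbd : b.arg < d.arg) :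
    u = v ∧ k = l := by
  have hda : d.arg < a.arg + 2 * Real.pi := by
    linarith [Complex.neg_pi_lt_arg a, Complex.arg_le_pi d]
  have pos {p q : ℂ} (hp : p ≠ 0) (hq : q ≠ 0) (h1 : p.arg < q.arg)
      (h2 : q.arg < p.arg + Real.pi) : 0 < planeCross p q :=
    planeCross_pos hp hq (Real.sin_pos_of_pos_of_lt_pi (by linarith) (by linarith))
  have pos' {p q : ℂ} (hp : p ≠ 0) (hq : q ≠ 0) (h1 : p.arg + Real.pi < q.arg)
      (h2 : q.arg < p.arg + 2 * Real.pi) : 0 < planeCross q p := by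
    apply planeCross_pos hq hp
    rw [← Real.sin_add_two_pi]
    exact Real.sin_pos_of_pos_of_lt_pi (by linarith) (by linarith)
  have zero {p q : ℂ} (h1 : q.arg = p.arg + Real.pi) : planeCross p q = 0 := by
    rw [planeCross_eq, h1]; simp
  have zero' {p q : ℂ} (h1 : q.arg = p.arg + Real.pi) : planeCross q p = 0 := by
    rw [planeCross_eq, h1]; simp
  rcases le_total l k with h | h
  · rcases le_or_gt d.arg (c.arg + Real.pi) with h1 | h1
    · refine circle_eq_of_mem_cone hl h ha hb hc hd ha' hb' hc' hd' (pos b0 d0 hbd (by linarith))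
        (pos c0 b0 hcb (by linarith)) ?_
      rcases h1.lt_or_eq with h2 | h2
      · exact .inl (pos c0 d0 (by linarith) h2)
      · exact .inr ⟨zero h2, pos a0 c0 hac (by linarith)⟩
    · exact circle_eq_of_mem_cone hl h hb ha hd hc hb' ha' hd' hc' (pos a0 c0 hac (by linarith))
        (pos' a0 d0 (by linarith) hda) (.inl (pos' c0 d0 h1 (by linarith)))
  · suffices hs : v = u ∧ l = k from ⟨hs.1.symm, hs.2.symm⟩
    rcases lt_or_ge (a.arg + Real.pi) b.arg with h1 | h1
    · exact circle_eq_of_mem_cone hk h hc hd hb ha hc' hd' hb' ha'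
        (pos' a0 d0 (by linarith) hda) (pos b0 d0 hbd (by linarith))
        (.inl (pos' a0 b0 h1 (by linarith)))
    · refine circle_eq_of_mem_cone hk h hd hc ha hb hd' hc' ha' hb'
        (pos c0 b0 hcb (by linarith)) (pos a0 c0 hac (by linarith)) ?_
      rcases h1.lt_or_eq with h2 | h2
      · exact .inl (pos a0 b0 (by linarith) h2)
      · exact .inr ⟨zero h2, pos' a0 d0 (by linarith) hda⟩

theorem eq_of_arg_eq {a b u v : ℂ} {k l : ℝ} (hk : 0 < k) (hl : 0 < l) (a0 : a ≠ 0) (b0 : b ≠ 0)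
    (ha : circlePower u k a = 0) (hb : circlePower v l b = 0)
    (ha' : 0 ≤ circlePower v l a) (hb' : 0 ≤ circlePower u k b) (hab : a.arg = b.arg) : a = b := by
  have aux {a u : ℂ} {k s : ℝ} (hk : 0 < k) (hs : 0 < s) (a0 : a ≠ 0) (ha : circlePower u k a = 0)
      (hb : 0 ≤ circlePower u k (s * a)) : 1 ≤ s := by
    simp only [circlePower, Complex.mul_re, Complex.mul_im, Complex.ofReal_re,
      Complex.ofReal_im] at ha hb
    have e : (s - 1) * (s * (a.re ^ 2 + a.im ^ 2) + k) =
      (s * a.re - 0 * a.im) ^ 2 + (s * a.im + 0 * a.re) ^ 2 -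
        2 * (u.re * (s * a.re - 0 * a.im) + u.im * (s * a.im + 0 * a.re)) - k := by
      linear_combination -s * ha
    rw [← e] at hb
    have : 0 < s * (a.re ^ 2 + a.im ^ 2) + k := by positivity
    have := nonneg_of_mul_nonneg_left hb this
    linarith
  obtain ⟨s, hs, rfl⟩ : ∃ s : ℝ, 0 < s ∧ b = s * a := by
    have na := norm_pos_iff.2 a0
    have nb := norm_pos_iff.2 b0
    refine ⟨‖b‖ / ‖a‖, by positivity, ?_⟩
    have := (Complex.arg_eq_arg_iff a0 b0).1 hab
    push_cast; exact this.symm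
  have h1 := aux hk hs a0 ha hb'
  have h2 : 1 ≤ s⁻¹ := by
    apply aux hl (inv_pos.2 hs) b0 hb
    rwa [← mul_assoc, ← Complex.ofReal_mul, inv_mul_cancel₀ hs.ne', Complex.ofReal_one, one_mul]
  have : s = 1 := le_antisymm (by rwa [one_le_inv₀ hs] at h2) h1
  simp [this]

open EuclideanGeometry in
theorem sin_angle_sq_mul_radius_sq {a b x o : EuclideanSpace ℝ (Fin 2)} {ρ : ℝ}
    (ha : dist a o = ρ) (hb : dist b o = ρ) :
    4 * ρ ^ 2 * Real.sin (∠ a x b) ^ 2 * (dist a x ^ 2 * dist b x ^ 2) =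
      (dist a x ^ 2 * dist b x ^ 2 + (ρ ^ 2 - dist x o ^ 2) *
        (ρ ^ 2 - dist x o ^ 2 + 2 * inner ℝ (a -ᵥ x) (b -ᵥ x))) * dist a b ^ 2 := by
  have hs : Real.sin (∠ a x b) ^ 2 * (dist a x ^ 2 * dist b x ^ 2)
      = dist a x ^ 2 * dist b x ^ 2 - inner ℝ (a -ᵥ x) (b -ᵥ x) ^ 2 := by
    have h := InnerProductGeometry.cos_angle_mul_norm_mul_norm (a -ᵥ x) (b -ᵥ x)
    rw [← h, dist_eq_norm_vsub (EuclideanSpace ℝ (Fin 2)) a x,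
      dist_eq_norm_vsub (EuclideanSpace ℝ (Fin 2)) b x, Real.sin_sq]
    unfold EuclideanGeometry.angle
    ring
  rw [mul_assoc, hs]
  have ha2 : dist a o ^ 2 = ρ ^ 2 := by rw [ha]
  have hb2 : dist b o ^ 2 = ρ ^ 2 := by rw [hb]
  clear hs ha hb
  simp only [EuclideanSpace.dist_sq_eq, Fin.sum_univ_two, PiLp.inner_apply, Real.dist_eq, sq_abs,
    vsub_eq_sub, PiLp.sub_apply, RCLike.inner_apply, conj_trivial] at *
  obtain ⟨k, hk⟩ : ∃ k, k = ρ ^ 2 - ((x 0 - o 0) ^ 2 + (x 1 - o 1) ^ 2) := ⟨_, rfl⟩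
  obtain ⟨a1, ea1⟩ : ∃ t, t = a 0 - x 0 := ⟨_, rfl⟩
  obtain ⟨a2, ea2⟩ : ∃ t, t = a 1 - x 1 := ⟨_, rfl⟩
  obtain ⟨b1, eb1⟩ : ∃ t, t = b 0 - x 0 := ⟨_, rfl⟩
  obtain ⟨b2, eb2⟩ : ∃ t, t = b 1 - x 1 := ⟨_, rfl⟩
  obtain ⟨o1, eo1⟩ : ∃ t, t = o 0 - x 0 := ⟨_, rfl⟩
  obtain ⟨o2, eo2⟩ : ∃ t, t = o 1 - x 1 := ⟨_, rfl⟩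
  have hρ : ρ ^ 2 = k + o1 ^ 2 + o2 ^ 2 := by rw [hk, eo1, eo2]; ring
  rw [← hk, ← ea1, ← ea2, ← eb1, ← eb2,
    show a 0 - b 0 = a1 - b1 by rw [ea1, eb1]; ring,
    show a 1 - b 1 = a2 - b2 by rw [ea2, eb2]; ring, hρ]
  rw [hρ, show a 0 - o 0 = a1 - o1 by rw [ea1, eo1]; ring,
    show a 1 - o 1 = a2 - o2 by rw [ea2, eo2]; ring] at ha2
  rw [hρ, show b 0 - o 0 = b1 - o1 by rw [eb1, eo1]; ring,
    show b 1 - o 1 = b2 - o2 by rw [eb2, eo2]; ring] at hb2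
  have hp : 2 * (o1 * a1 + o2 * a2) = a1 ^ 2 + a2 ^ 2 - k := by linarith
  have hq : 2 * (o1 * b1 + o2 * b2) = b1 ^ 2 + b2 ^ 2 - k := by linarith
  have hX1 : 2 * (a1 * b2 - a2 * b1) * o1
      = (a1 ^ 2 + a2 ^ 2 - k) * b2 - (b1 ^ 2 + b2 ^ 2 - k) * a2 := by rw [← hp, ← hq]; ring
  have hX2 : 2 * (a1 * b2 - a2 * b1) * o2
      = (b1 ^ 2 + b2 ^ 2 - k) * a1 - (a1 ^ 2 + a2 ^ 2 - k) * b1 := by rw [← hp, ← hq]; ring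
  have : 4 * (k + o1 ^ 2 + o2 ^ 2) * ((a1 ^ 2 + a2 ^ 2) * (b1 ^ 2 + b2 ^ 2)
      - (b1 * a1 + b2 * a2) ^ 2)
      = 4 * k * (a1 * b2 - a2 * b1) ^ 2 + (2 * (a1 * b2 - a2 * b1) * o1) ^ 2
        + (2 * (a1 * b2 - a2 * b1) * o2) ^ 2 := by ring
  rw [this, hX1, hX2]
  ring

open EuclideanGeometry in
theorem le_angle_of_mem_circumdisk {a b c x o : EuclideanSpace ℝ (Fin 2)} {ρ α : ℝ} (hα : 0 < α)
    (hac : a ≠ c) (hbc : b ≠ c)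
    (ha : dist a o = ρ) (hb : dist b o = ρ) (hc : dist c o = ρ) (hx : dist x o < ρ)
    (h₁ : α ≤ ∠ a c b) (h₂ : α ≤ ∠ c b a) (h₃ : α ≤ ∠ b a c) : α ≤ ∠ a x b := by
  have hsum : ∠ a c b + ∠ c b a + ∠ b a c = Real.pi := angle_add_angle_add_angle_eq_pi b hac.symm
  by_contra! hlt
  have hax : 0 < dist a x := dist_pos.2 (by rintro rfl; linarith)
  have hbx : 0 < dist b x := dist_pos.2 (by rintro rfl; linarith)
  have hac' : 0 < dist a c := dist_pos.2 hac
  have hbc' : 0 < dist b c := dist_pos.2 hbc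
  have hρ : 0 < ρ := dist_nonneg.trans_lt hx
  have hin : 0 ≤ inner ℝ (a -ᵥ x) (b -ᵥ x) := by
    rw [← InnerProductGeometry.cos_angle_mul_norm_mul_norm]
    refine mul_nonneg (Real.cos_nonneg_of_mem_Icc ⟨?_, ?_⟩) (by positivity)
    · linarith [InnerProductGeometry.angle_nonneg (a -ᵥ x) (b -ᵥ x), Real.pi_pos]
    · change ∠ a x b ≤ _
      linarith
  have hk : 0 ≤ ρ ^ 2 - dist x o ^ 2 := by
    have := pow_le_pow_left₀ dist_nonneg hx.le 2
    linarith
  have e₁ : 4 * ρ ^ 2 * Real.sin (∠ a c b) ^ 2 = dist a b ^ 2 := by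
    have h := sin_angle_sq_mul_radius_sq (x := c) ha hb
    rw [hc, sub_self, zero_mul, add_zero, mul_comm _ (dist a b ^ 2)] at h
    exact mul_right_cancel₀ (by positivity) h
  have e₂ : dist a b ^ 2 ≤ 4 * ρ ^ 2 * Real.sin (∠ a x b) ^ 2 := by
    have h := sin_angle_sq_mul_radius_sq (x := x) ha hb
    have h' : 0 ≤ (ρ ^ 2 - dist x o ^ 2) *
        (ρ ^ 2 - dist x o ^ 2 + 2 * inner ℝ (a -ᵥ x) (b -ᵥ x)) * dist a b ^ 2 := by positivity
    refine le_of_mul_le_mul_right ?_ (show 0 < dist a x ^ 2 * dist b x ^ 2 by positivity)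
    rw [h]
    linarith
  have h0 : 0 ≤ ∠ a x b := angle_nonneg _ _ _
  have s₁ : Real.sin (∠ a x b) < Real.sin α :=
    Real.sin_lt_sin_of_lt_of_le_pi_div_two (by linarith) (by linarith) hlt
  have s₂ : Real.sin α ≤ Real.sin (∠ a c b) := by
    rcases le_total (∠ a c b) (Real.pi / 2) with h | h
    · exact Real.sin_le_sin_of_le_of_le_pi_div_two (by linarith) h h₁
    · rw [← Real.sin_pi_sub (∠ a c b)]
      exact Real.sin_le_sin_of_le_of_le_pi_div_two (by linarith) (by linarith) (by linarith)
  have s₀ : 0 ≤ Real.sin (∠ a x b) := InnerProductGeometry.sin_angle_nonneg _ _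
  have := pow_lt_pow_left₀ (s₁.trans_le s₂) s₀ two_ne_zero
  have : 4 * ρ ^ 2 * Real.sin (∠ a x b) ^ 2 < 4 * ρ ^ 2 * Real.sin (∠ a c b) ^ 2 := by gcongr
  linarith

/-- The plane as the complex line, with `x` as origin. -/
noncomputable def toComplexAt (x p : EuclideanSpace ℝ (Fin 2)) : ℂ := ⟨p 0 - x 0, p 1 - x 1⟩

open EuclideanGeometry in
theorem angle_le_abs_arg_sub {x a b : EuclideanSpace ℝ (Fin 2)} (ha : a ≠ x) (hb : b ≠ x) :
    ∠ a x b ≤ |(toComplexAt x a).arg - (toComplexAt x b).arg| := by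
  have hn (p : EuclideanSpace ℝ (Fin 2)) : ‖toComplexAt x p‖ = ‖p -ᵥ x‖ := by
    rw [EuclideanSpace.norm_eq, Complex.norm_eq_sqrt_sq_add_sq]
    simp [toComplexAt, Fin.sum_univ_two]
  have hpos {p : EuclideanSpace ℝ (Fin 2)} (hp : p ≠ x) : 0 < ‖toComplexAt x p‖ := by
    rw [hn]; exact norm_pos_iff.2 (vsub_ne_zero.2 hp)
  have hin : inner ℝ (a -ᵥ x) (b -ᵥ x) = (toComplexAt x a).re * (toComplexAt x b).re
      + (toComplexAt x a).im * (toComplexAt x b).im := by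
    simp [toComplexAt, PiLp.inner_apply, Fin.sum_univ_two]
    ring
  have hcos : Real.cos (∠ a x b) = Real.cos ((toComplexAt x a).arg - (toComplexAt x b).arg) := by
    have h := InnerProductGeometry.cos_angle_mul_norm_mul_norm (a -ᵥ x) (b -ᵥ x)
    rw [hin, ← hn, ← hn] at h
    refine mul_right_cancel₀ (mul_pos (hpos ha) (hpos hb)).ne' (h.trans ?_)
    nth_rewrite 1 [← Complex.norm_mul_cos_arg (toComplexAt x a),
      ← Complex.norm_mul_cos_arg (toComplexAt x b), ← Complex.norm_mul_sin_arg (toComplexAt x a),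
      ← Complex.norm_mul_sin_arg (toComplexAt x b)]
    rw [Real.cos_sub]
    ring
  by_contra! h
  have := Real.cos_lt_cos_of_nonneg_of_le_pi (abs_nonneg _) (angle_le_pi a x b) h
  rw [Real.cos_abs] at this
  linarith

theorem circlePower_toComplexAt (x o p : EuclideanSpace ℝ (Fin 2)) (ρ : ℝ) :
    circlePower (toComplexAt x o) (ρ ^ 2 - dist x o ^ 2) (toComplexAt x p) =
      dist p o ^ 2 - ρ ^ 2 := by
  simp only [circlePower, toComplexAt, EuclideanSpace.dist_sq_eq, Fin.sum_univ_two, Real.dist_eq,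
    sq_abs]
  ring

theorem toComplexAt_injective (x : EuclideanSpace ℝ (Fin 2)) :
    Function.Injective (toComplexAt x) := by
  intro p q h
  simp only [toComplexAt, Complex.mk.injEq, sub_left_inj] at h
  ext i
  fin_cases i
  exacts [h.1, h.2]

theorem toComplexAt_ne_zero {x p : EuclideanSpace ℝ (Fin 2)} (h : p ≠ x) :
    toComplexAt x p ≠ 0 := by
  intro h0
  refine h (toComplexAt_injective x (h0.trans ?_))
  simp [toComplexAt, Complex.ext_iff]

/-- The open disk of center `o` and radius `ρ` contains `x` but no point of `S`. -/
structure IsEmptyDisk (S : Finset (EuclideanSpace ℝ (Fin 2))) (x o : EuclideanSpace ℝ (Fin 2))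
    (ρ : ℝ) : Prop where
  empty : ∀ p ∈ S, ρ ≤ dist p o
  mem : dist x o < ρ

namespace IsEmptyDisk

variable {S : Finset (EuclideanSpace ℝ (Fin 2))} {x o o' a b c d : EuclideanSpace ℝ (Fin 2)}
  {ρ ρ' : ℝ}

theorem pos (h : IsEmptyDisk S x o ρ) : 0 < ρ := dist_nonneg.trans_lt h.mem

theorem ne (h : IsEmptyDisk S x o ρ) (ha : a ∈ S) : a ≠ x := by
  rintro rfl
  exact (h.empty a ha).not_gt h.mem

theorem power_pos (h : IsEmptyDisk S x o ρ) : 0 < ρ ^ 2 - dist x o ^ 2 :=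
  sub_pos.2 (pow_lt_pow_left₀ h.mem dist_nonneg two_ne_zero)

theorem circlePower_nonneg (h : IsEmptyDisk S x o ρ) (ha : a ∈ S) :
    0 ≤ circlePower (toComplexAt x o) (ρ ^ 2 - dist x o ^ 2) (toComplexAt x a) := by
  rw [circlePower_toComplexAt]
  exact sub_nonneg.2 (pow_le_pow_left₀ h.pos.le (h.empty a ha) 2)

theorem eq_of_interleave (h : IsEmptyDisk S x o ρ) (h' : IsEmptyDisk S x o' ρ')
    (ha : a ∈ S ∧ dist a o = ρ) (hb : b ∈ S ∧ dist b o = ρ)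
    (hc : c ∈ S ∧ dist c o' = ρ') (hd : d ∈ S ∧ dist d o' = ρ')
    (hac : (toComplexAt x a).arg < (toComplexAt x c).arg)
    (hcb : (toComplexAt x c).arg < (toComplexAt x b).arg)
    (hbd : (toComplexAt x b).arg < (toComplexAt x d).arg) : o = o' ∧ ρ = ρ' := by
  have hz {p o : EuclideanSpace ℝ (Fin 2)} {ρ : ℝ} (hp : p ∈ S ∧ dist p o = ρ) :
      circlePower (toComplexAt x o) (ρ ^ 2 - dist x o ^ 2) (toComplexAt x p) = 0 := by
    rw [circlePower_toComplexAt, hp.2, sub_self]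
  obtain ⟨h₁, h₂⟩ := circle_eq_of_interleave h.power_pos h'.power_pos
    (toComplexAt_ne_zero (h.ne ha.1)) (toComplexAt_ne_zero (h.ne hb.1))
    (toComplexAt_ne_zero (h.ne hc.1)) (toComplexAt_ne_zero (h.ne hd.1))
    (hz ha) (hz hb) (hz hc) (hz hd)
    (h'.circlePower_nonneg ha.1) (h'.circlePower_nonneg hb.1)
    (h.circlePower_nonneg hc.1) (h.circlePower_nonneg hd.1) hac hcb hbd
  obtain rfl := toComplexAt_injective x h₁
  exact ⟨rfl, (pow_left_inj₀ h.pos.le h'.pos.le two_ne_zero).1 (sub_left_injective h₂)⟩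

theorem eq_of_arg_eq (h : IsEmptyDisk S x o ρ) (h' : IsEmptyDisk S x o' ρ')
    (ha : a ∈ S ∧ dist a o = ρ) (hb : b ∈ S ∧ dist b o' = ρ')
    (hab : (toComplexAt x a).arg = (toComplexAt x b).arg) : a = b := by
  refine toComplexAt_injective x <| _root_.eq_of_arg_eq h.power_pos h'.power_pos
    (toComplexAt_ne_zero (h.ne ha.1)) (toComplexAt_ne_zero (h.ne hb.1)) ?_ ?_
    (h'.circlePower_nonneg ha.1) (h.circlePower_nonneg hb.1) hab
  · rw [circlePower_toComplexAt, ha.2, sub_self]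
  · rw [circlePower_toComplexAt, hb.2, sub_self]

end IsEmptyDisk

/-- The points `i`, `j`, `k` of `S` lie on the circle of center `o` and radius `ρ`, whose open disk
contains `x` but no point of `S`, and as seen from `x` their directions increase in steps of at
least `α`. -/
structure IsConflictTriangle (S : Finset (EuclideanSpace ℝ (Fin 2))) (α : ℝ)
    (x i j k o : EuclideanSpace ℝ (Fin 2)) (ρ : ℝ) : Prop extends IsEmptyDisk S x o ρ where
  left : i ∈ S ∧ dist i o = ρ
  middle : j ∈ S ∧ dist j o = ρ
  right : k ∈ S ∧ dist k o = ρ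
  left_le : (toComplexAt x i).arg + α ≤ (toComplexAt x j).arg
  le_right : (toComplexAt x j).arg + α ≤ (toComplexAt x k).arg

theorem IsConflictTriangle.separated {S : Finset (EuclideanSpace ℝ (Fin 2))} {α : ℝ} (hα : 0 < α)
    {x i j k o i' j' k' o' : EuclideanSpace ℝ (Fin 2)} {ρ ρ' : ℝ}
    (h : IsConflictTriangle S α x i j k o ρ) (h' : IsConflictTriangle S α x i' j' k' o' ρ')
    (hj : (toComplexAt x j).arg ≤ (toComplexAt x j').arg)
    (hlt : (toComplexAt x j').arg < (toComplexAt x j).arg + α) :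
    (o = o' ∧ ρ = ρ') ∨ (i = i' ∧ j = j' ∧ k = k') := by
  have h₁ := h.left_le
  have h₂ := h.le_right
  have h₁' := h'.left_le
  have h₂' := h'.le_right
  have e := h.toIsEmptyDisk
  have e' := h'.toIsEmptyDisk
  have symm (hs : o' = o ∧ ρ' = ρ) : (o = o' ∧ ρ = ρ') ∨ (i = i' ∧ j = j' ∧ k = k') :=
    .inl ⟨hs.1.symm, hs.2.symm⟩
  rcases hj.lt_or_eq with hj | hj
  · exact symm (e'.eq_of_interleave e h'.left h'.middle h.middle h.right
      (by linarith) hj (by linarith))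
  rcases lt_trichotomy (toComplexAt x i).arg (toComplexAt x i').arg with hi | hi | hi
  · exact .inl (e.eq_of_interleave e' h.left h.middle h'.left h'.right hi
      (by linarith) (by linarith))
  · rcases lt_trichotomy (toComplexAt x k).arg (toComplexAt x k').arg with hk | hk | hk
    · exact .inl (e.eq_of_interleave e' h.left h.right h'.middle h'.right
        (by linarith) (by linarith) hk)
    · exact .inr ⟨e.eq_of_arg_eq e' h.left h'.left hi, e.eq_of_arg_eq e' h.middle h'.middle hj,
        e.eq_of_arg_eq e' h.right h'.right hk⟩
    · exact symm (e'.eq_of_interleave e h'.left h'.right h.middle h.right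
        (by linarith) (by linarith) hk)
  · exact symm (e'.eq_of_interleave e h'.left h'.middle h.left h.right hi
      (by linarith) (by linarith))

theorem exists_isConflictTriangle {S : Finset (EuclideanSpace ℝ (Fin 2))} {α : ℝ} (hα : 0 < α)
    {x q r s o : EuclideanSpace ℝ (Fin 2)} {ρ : ℝ} (h : IsEmptyDisk S x o ρ)
    (hqr : q ≠ r) (hqs : q ≠ s) (hrs : r ≠ s)
    (hq : q ∈ S ∧ dist q o = ρ) (hr : r ∈ S ∧ dist r o = ρ) (hs : s ∈ S ∧ dist s o = ρ)
    (aq : α ≤ EuclideanGeometry.angle r q s) (ar : α ≤ EuclideanGeometry.angle q r s)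
    (as : α ≤ EuclideanGeometry.angle q s r) :
    ∃ i j k, ({q, r, s} : Set (EuclideanSpace ℝ (Fin 2))) = {i, j, k} ∧
      IsConflictTriangle S α x i j k o ρ := by
  have comm := @EuclideanGeometry.angle_comm (EuclideanSpace ℝ (Fin 2))
    (EuclideanSpace ℝ (Fin 2)) _ _ _ _
  have h₁ := (le_angle_of_mem_circumdisk hα hqs hrs hq.2 hr.2 hs.2 h.mem as
    (comm q r s ▸ ar) aq).trans (angle_le_abs_arg_sub (h.ne hq.1) (h.ne hr.1))
  have h₂ := (le_angle_of_mem_circumdisk hα hqr hrs.symm hq.2 hs.2 hr.2 h.mem ar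
    (comm q s r ▸ as) (comm r q s ▸ aq)).trans (angle_le_abs_arg_sub (h.ne hq.1) (h.ne hs.1))
  have h₃ := (le_angle_of_mem_circumdisk hα hqr.symm hqs.symm hr.2 hs.2 hq.2 h.mem aq
    (comm q s r ▸ as) (comm q r s ▸ ar)).trans (angle_le_abs_arg_sub (h.ne hr.1) (h.ne hs.1))
  rw [le_abs] at h₁ h₂ h₃
  rcases h₁ with h₁ | h₁ <;> rcases h₂ with h₂ | h₂ <;> rcases h₃ with h₃ | h₃
  · exact ⟨s, r, q, by ext; simp; tauto, h, hs, hr, hq, by linarith, by linarith⟩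
  · exact ⟨r, s, q, by ext; simp; tauto, h, hr, hs, hq, by linarith, by linarith⟩
  · linarith
  · exact ⟨r, q, s, by ext; simp; tauto, h, hr, hq, hs, by linarith, by linarith⟩
  · exact ⟨s, q, r, by ext; simp; tauto, h, hs, hq, hr, by linarith, by linarith⟩
  · linarith
  · exact ⟨q, s, r, by ext; simp; tauto, h, hq, hs, hr, by linarith, by linarith⟩
  · exact ⟨q, r, s, rfl, h, hq, hr, hs, by linarith, by linarith⟩

theorem ncard_le_of_separated {ι : Type*} {F : Set ι} {m : ι → ℝ} {l w α : ℝ} (hα : 0 < α)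
    (hw : 0 ≤ w) (hl : ∀ t ∈ F, l ≤ m t) (hu : ∀ t ∈ F, m t + α ≤ l + w)
    (hsep : ∀ t ∈ F, ∀ t' ∈ F, m t ≤ m t' → m t' < m t + α → t = t') :
    (F.ncard : ℝ) ≤ w / α := by
  have hnn (t) (ht : t ∈ F) : 0 ≤ (m t - l) / α := div_nonneg (sub_nonneg.2 (hl t ht)) hα.le
  have hmaps : ∀ t ∈ F, ⌊(m t - l) / α⌋₊ ∈ (Finset.range ⌊w / α⌋₊ : Set ℕ) := by
    intro t ht
    rw [Finset.mem_coe, Finset.mem_range, ← Nat.succ_le_iff]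
    refine Nat.le_floor ?_
    push_cast
    have h₁ := Nat.floor_le (hnn t ht)
    have h₂ : (m t - l) / α + 1 ≤ w / α := by
      rw [div_add_one hα.ne']
      gcongr
      linarith [hu t ht]
    linarith
  have hinj : Set.InjOn (fun t ↦ ⌊(m t - l) / α⌋₊) F := by
    have aux (t) (ht : t ∈ F) (t') (ht' : t' ∈ F)
        (h : ⌊(m t - l) / α⌋₊ = ⌊(m t' - l) / α⌋₊) : m t' < m t + α := by
      have h₁ := Nat.floor_le (hnn t ht)
      have h₂ := Nat.lt_floor_add_one ((m t' - l) / α)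
      rw [← h] at h₂
      have h₃ : (m t' - l) / α < (m t - l) / α + 1 := by linarith
      rw [div_add_one hα.ne', div_lt_div_iff_of_pos_right hα] at h₃
      linarith
    intro t ht t' ht' h
    rcases le_total (m t) (m t') with hle | hle
    · exact hsep t ht t' ht' hle (aux t ht t' ht' h)
    · exact (hsep t' ht' t ht hle (aux t' ht' t ht h.symm)).symm
  have := Set.ncard_le_ncard_of_injOn _ hmaps hinj (Finset.finite_toSet _)
  rw [Set.ncard_coe_finset, Finset.card_range] at this
  exact (Nat.cast_le.2 this).trans (Nat.floor_le (by positivity))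

/-- Lemma 2, bounded coverage. Let `S` be a finite set of points of the
plane in general position (no three collinear, no four concyclic) and let `α > 0` be such
that every triangle on vertices of `S` whose open circumdisk contains no point of `S`
(i.e. every Delaunay triangle of `S`) has all three angles at least `α`. Then for every
point `x` of the plane the number of three-element subsets of `S` spanning a triangle
whose open circumdisk is empty of points of `S` but contains `x` is at most `2π/α`. -/
theorem delaunay_bounded_coverage
    (S : Finset (EuclideanSpace ℝ (Fin 2))) (α : ℝ) (hα : 0 < α)
    (hgen₃ : ∀ p q r, p ∈ S → q ∈ S → r ∈ S → p ≠ q → p ≠ r → q ≠ r →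
      ¬ Collinear ℝ ({p, q, r} : Set (EuclideanSpace ℝ (Fin 2))))
    (hgen₄ : ∀ p q r s, p ∈ S → q ∈ S → r ∈ S → s ∈ S →
      p ≠ q → p ≠ r → p ≠ s → q ≠ r → q ≠ s → r ≠ s →
      ¬ ∃ (o : EuclideanSpace ℝ (Fin 2)) (ρ : ℝ),
          dist p o = ρ ∧ dist q o = ρ ∧ dist r o = ρ ∧ dist s o = ρ)
    (hangle : ∀ q r s, q ∈ S → r ∈ S → s ∈ S →
      AffineIndependent ℝ ![q, r, s] →
      (∃ (o : EuclideanSpace ℝ (Fin 2)) (ρ : ℝ),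
          dist q o = ρ ∧ dist r o = ρ ∧ dist s o = ρ ∧ ∀ p ∈ S, ρ ≤ dist p o) →
      α ≤ EuclideanGeometry.angle r q s ∧ α ≤ EuclideanGeometry.angle q r s ∧
        α ≤ EuclideanGeometry.angle q s r)
    (x : EuclideanSpace ℝ (Fin 2)) :
    (({t : Finset (EuclideanSpace ℝ (Fin 2)) | t ⊆ S ∧ t.card = 3 ∧
        ∃ q r s, (t : Set (EuclideanSpace ℝ (Fin 2))) = {q, r, s} ∧ AffineIndependent ℝ ![q, r, s] ∧
          ∃ (o : EuclideanSpace ℝ (Fin 2)) (ρ : ℝ),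
            dist q o = ρ ∧ dist r o = ρ ∧ dist s o = ρ ∧
            (∀ p ∈ S, ρ ≤ dist p o) ∧ dist x o < ρ}).ncard : ℝ) ≤
      2 * Real.pi / α := by
  set F := {t : Finset (EuclideanSpace ℝ (Fin 2)) | t ⊆ S ∧ t.card = 3 ∧
    ∃ q r s, (t : Set (EuclideanSpace ℝ (Fin 2))) = {q, r, s} ∧ AffineIndependent ℝ ![q, r, s] ∧
      ∃ (o : EuclideanSpace ℝ (Fin 2)) (ρ : ℝ),
        dist q o = ρ ∧ dist r o = ρ ∧ dist s o = ρ ∧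
        (∀ p ∈ S, ρ ≤ dist p o) ∧ dist x o < ρ}
  have key : ∀ t : Finset (EuclideanSpace ℝ (Fin 2)), ∃ i j k o ρ, t ∈ F →
      (t : Set (EuclideanSpace ℝ (Fin 2))) = {i, j, k} ∧
        IsConflictTriangle S α x i j k o ρ := by
    intro t
    by_cases ht : t ∈ F
    swap
    · exact ⟨x, x, x, x, 0, fun h ↦ absurd h ht⟩
    obtain ⟨hS, -, q, r, s, hqrs, hind, o, ρ, hq, hr, hs, hemp, hx⟩ := ht
    have mem {p} (hp : p ∈ ({q, r, s} : Set (EuclideanSpace ℝ (Fin 2)))) : p ∈ S :=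
      hS (Finset.mem_coe.1 (hqrs ▸ hp))
    have mq : q ∈ S := mem (by simp)
    have mr : r ∈ S := mem (by simp)
    have ms : s ∈ S := mem (by simp)
    have hqr : q ≠ r := by simpa using hind.injective.ne (show (0 : Fin 3) ≠ 1 by decide)
    have hqs : q ≠ s := by simpa using hind.injective.ne (show (0 : Fin 3) ≠ 2 by decide)
    have hrs : r ≠ s := by simpa using hind.injective.ne (show (1 : Fin 3) ≠ 2 by decide)
    obtain ⟨aq, ar, as⟩ := hangle q r s mq mr ms hind ⟨o, ρ, hq, hr, hs, hemp⟩
    obtain ⟨i, j, k, h, h'⟩ := exists_isConflictTriangle hα ⟨hemp, hx⟩ hqr hqs hrs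
      ⟨mq, hq⟩ ⟨mr, hr⟩ ⟨ms, hs⟩ aq ar as
    exact ⟨i, j, k, o, ρ, fun _ ↦ ⟨hqrs.trans h, h'⟩⟩
  choose i j k o ρ H using key
  refine ncard_le_of_separated (m := fun t ↦ (toComplexAt x (j t)).arg) (l := -Real.pi) hα
    Real.two_pi_pos.le (fun t _ ↦ (Complex.neg_pi_lt_arg _).le) (fun t ht ↦ ?_)
    fun t ht t' ht' hle hlt ↦ ?_
  · have := (H t ht).2.le_right
    linarith [Complex.arg_le_pi (toComplexAt x (k t))]
  obtain ⟨e, h⟩ := H t ht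
  obtain ⟨e', h'⟩ := H t' ht'
  rcases h.separated hα h' hle hlt with ⟨ho, hρ⟩ | ⟨hi, hj, hk⟩
  · symm
    refine Finset.eq_of_subset_of_card_le (fun p hp ↦ ?_) (by rw [ht.2.1, ht'.2.1])
    by_contra hpt
    have hp' : p ∈ ({i t', j t', k t'} : Set (EuclideanSpace ℝ (Fin 2))) :=
      e' ▸ Finset.mem_coe.2 hp
    have hpS : p ∈ S ∧ dist p (o t) = ρ t := by
      rw [ho, hρ]
      rcases hp' with rfl | rfl | rfl
      exacts [h'.left, h'.middle, h'.right]
    rw [← Finset.mem_coe, e] at hpt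
    simp only [Set.mem_insert_iff, Set.mem_singleton_iff, not_or] at hpt
    have ne {a b : EuclideanSpace ℝ (Fin 2)}
        (hab : (toComplexAt x a).arg + α ≤ (toComplexAt x b).arg) : a ≠ b := by
      rintro rfl
      linarith
    exact hgen₄ p (i t) (j t) (k t) hpS.1 h.left.1 h.middle.1 h.right.1 hpt.1 hpt.2.1 hpt.2.2
      (ne h.left_le) (ne (by linarith [h.left_le, h.le_right])) (ne h.le_right)
      ⟨o t, ρ t, hpS.2, h.left.2, h.middle.2, h.right.2⟩
  · exact Finset.coe_injective (by rw [e, e', hi, hj, hk])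
end
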